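/- Let n ≥ 2 and 0 < μ < n. Suppose u ∈ Cⁿ(ℝⁿ) satisfies condition (B) and the integral equation (IE). Then α = 2; that is, ∫_{ℝⁿ} v(y) e^{((2n−μ)/2) u(y)} dy = 2 βₙ. -/

import Mathlib

open MeasureTheory Real Filter Metric

noncomputable section

/-- The nonlocal term `v(x) = ∫ e^{((2n-μ)/2) u(y)} / |x-y|^μ dy`. -/
noncomputable def V (n : ℕ) (μ : ℝ) (u : EuclideanSpace ℝ (Fin n) → ℝ)
    (x : EuclideanSpace ℝ (Fin n)) : ℝ :=
  ∫ y : EuclideanSpace ℝ (Fin n),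
    Real.exp ((2 * n - μ) / 2 * u y) / ‖x - y‖ ^ μ

/-- `βₙ = 2^{n-1} Γ(n/2+1) Γ(n/2) ωₙ` with `ωₙ` the volume of the unit ball in `ℝⁿ`. -/
noncomputable def betaN (n : ℕ) : ℝ :=
  2 ^ (n - 1) * Real.Gamma ((n : ℝ) / 2 + 1) * Real.Gamma ((n : ℝ) / 2) *
    (volume (Metric.ball (0 : EuclideanSpace ℝ (Fin n)) 1)).toReal

/-- Condition (B): finite weighted volume and finite total curvature. -/
def CondB (n : ℕ) (μ : ℝ) (u : EuclideanSpace ℝ (Fin n) → ℝ) : Prop :=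
  Integrable (fun y : EuclideanSpace ℝ (Fin n) => Real.exp ((2 * n - μ) / 2 * u y)) ∧
  Integrable (fun p : EuclideanSpace ℝ (Fin n) × EuclideanSpace ℝ (Fin n) =>
    Real.exp ((2 * n - μ) / 2 * u p.1) * Real.exp ((2 * n - μ) / 2 * u p.2) / ‖p.1 - p.2‖ ^ μ)

/-- The integral equation (IE). -/
def IE (n : ℕ) (μ : ℝ) (u : EuclideanSpace ℝ (Fin n) → ℝ) : Prop :=
  ∃ C : ℝ, ∀ x : EuclideanSpace ℝ (Fin n), u x = (1 / betaN n) *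
    (∫ y, Real.log ((‖y‖ + 1) / ‖x - y‖) * (V n μ u y * Real.exp ((2 * n - μ) / 2 * u y))) + C

/-- `α = (1/βₙ) ∫ v(y) e^{((2n-μ)/2) u(y)} dy`. -/
noncomputable def alphaC (n : ℕ) (μ : ℝ) (u : EuclideanSpace ℝ (Fin n) → ℝ) : ℝ :=
  (1 / betaN n) * ∫ y, V n μ u y * Real.exp ((2 * n - μ) / 2 * u y)

section Riesz

variable {E : Type*} [NormedAddCommGroup E] [InnerProductSpace ℝ E] [FiniteDimensional ℝ E]
  [MeasurableSpace E] [BorelSpace E]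

/-- Local integrability of a negative power of the norm, below the dimension. -/
theorem integrable_indicator_inv_norm_rpow {s : ℝ}
    (hs : s < Module.finrank ℝ E) (hE : 0 < Module.finrank ℝ E) :
    Integrable ((ball (0 : E) 1).indicator fun z => 1 / ‖z‖ ^ s) := by
  have : Nontrivial E := Module.nontrivial_of_finrank_pos hE
  rw [integrable_indicator_iff measurableSet_ball,
    integrableOn_fun_norm_addHaar volume (f := fun t : ℝ => 1 / t ^ s)]
  have h : IntegrableOn (fun t : ℝ => t ^ ((Module.finrank ℝ E : ℝ) - 1 - s)) (Set.Ioo 0 1) :=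
    (intervalIntegral.integrableOn_Ioo_rpow_iff one_pos).2 (by linarith)
  refine h.congr_fun (fun t ht => ?_) measurableSet_Ioo
  have ht0 : 0 < t := ht.1
  simp only [smul_eq_mul]
  rw [rpow_sub ht0, ← rpow_natCast, Nat.cast_sub hE, Nat.cast_one, mul_one_div]

/-- Riesz potentials of locally bounded integrable functions are locally bounded. -/
theorem riesz_potential_bound {s : ℝ} (hs0 : 0 ≤ s)
    (hs : s < Module.finrank ℝ E) (hE : 0 < Module.finrank ℝ E) {w : E → ℝ} (hw : Integrable w)
    (hloc : ∀ R : ℝ, ∃ M : ℝ, ∀ x, ‖x‖ ≤ R → |w x| ≤ M) (R : ℝ) :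
    ∃ C : ℝ, ∀ x, ‖x‖ ≤ R → Integrable (fun y => w y / ‖x - y‖ ^ s) ∧
      ∫ y, |w y| / ‖x - y‖ ^ s ≤ C := by
  obtain ⟨M, hM⟩ := hloc (R + 1)
  set g : E → ℝ := (ball (0 : E) 1).indicator fun z => 1 / ‖z‖ ^ s with hg
  have hgi : Integrable g := integrable_indicator_inv_norm_rpow hs hE
  refine ⟨(∫ z, M * g z) + ∫ y, |w y|, fun x hx => ?_⟩
  have hgx : Integrable fun y => M * g (x - y) := (hgi.comp_sub_left x).const_mul M
  have hbound : ∀ y, |w y| / ‖x - y‖ ^ s ≤ M * g (x - y) + |w y| := by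
    intro y
    by_cases hxy : ‖x - y‖ < 1
    · have h1 : g (x - y) = 1 / ‖x - y‖ ^ s := by
        rw [hg, Set.indicator_of_mem]; simpa using hxy
      have h2 : ‖y‖ ≤ R + 1 := by
        have := norm_sub_norm_le y x
        rw [norm_sub_rev] at this; linarith
      rw [h1, mul_one_div]
      have : |w y| / ‖x - y‖ ^ s ≤ M / ‖x - y‖ ^ s := by gcongr; exact hM y h2
      linarith [abs_nonneg (w y)]
    · have h1 : g (x - y) = 0 := by
        rw [hg, Set.indicator_of_notMem]; simpa using hxy
      rw [h1, mul_zero, zero_add]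
      exact div_le_self (abs_nonneg _) (one_le_rpow (not_lt.1 hxy) hs0)
  have hmeas : AEStronglyMeasurable (fun y => w y / ‖x - y‖ ^ s) volume :=
    hw.1.div₀ (by fun_prop)
  have hint : Integrable (fun y => w y / ‖x - y‖ ^ s) := by
    refine (hgx.add hw.abs).mono' hmeas (ae_of_all _ fun y => ?_)
    rw [norm_div, norm_eq_abs, norm_eq_abs, abs_of_nonneg (rpow_nonneg (norm_nonneg _) s)]
    exact hbound y
  refine ⟨hint, ?_⟩
  calc ∫ y, |w y| / ‖x - y‖ ^ s ≤ ∫ y, (M * g (x - y) + |w y|) :=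
        integral_mono_of_nonneg (ae_of_all _ fun y => by positivity) (hgx.add hw.abs)
          (ae_of_all _ hbound)
    _ = _ := by
        rw [integral_add hgx hw.abs, integral_sub_left_eq_self (fun z => M * g z) volume x]

theorem integrable_prod_riesz {s : ℝ} (hs0 : 0 ≤ s)
    (hs : s < Module.finrank ℝ E) (hE : 0 < Module.finrank ℝ E) {w : E → ℝ} (hw : Integrable w)
    (hloc : ∀ R : ℝ, ∃ M : ℝ, ∀ x, ‖x‖ ≤ R → |w x| ≤ M) {r : E → ℝ} (hr : Integrable r) {R : ℝ}
    (hrR : ∀ x, R < ‖x‖ → r x = 0) :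
    Integrable fun p : E × E => r p.1 * w p.2 / ‖p.1 - p.2‖ ^ s := by
  obtain ⟨C, hC⟩ := riesz_potential_bound hs0 hs hE hw hloc R
  have hmeas : AEStronglyMeasurable (fun p : E × E => r p.1 * w p.2 / ‖p.1 - p.2‖ ^ s)
      (volume.prod volume) :=
    (hr.1.comp_fst.mul hw.1.comp_snd).div₀ (by fun_prop)
  refine (integrable_prod_iff hmeas).2 ⟨ae_of_all _ fun x => ?_, ?_⟩
  · by_cases hx : ‖x‖ ≤ R
    · simpa only [mul_div_assoc] using (hC x hx).1.const_mul (r x)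
    · simp [hrR x (not_le.1 hx)]
  · refine (hr.abs.mul_const C).mono' hmeas.norm.integral_prod_right' (ae_of_all _ fun x => ?_)
    by_cases hx : ‖x‖ ≤ R
    · have h1 : ∀ y, ‖r x * w y / ‖x - y‖ ^ s‖ = |r x| * (|w y| / ‖x - y‖ ^ s) := fun y => by
        rw [norm_div, norm_mul, mul_div_assoc, norm_eq_abs, norm_eq_abs, norm_eq_abs,
          abs_of_nonneg (rpow_nonneg (norm_nonneg (x - y)) s)]
      simp only [h1]
      rw [integral_const_mul, norm_eq_abs, abs_mul, abs_abs]
      gcongr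
      rw [abs_of_nonneg (integral_nonneg fun y => by positivity)]
      exact (hC x hx).2
    · simp [hrR x (not_le.1 hx)]

end Riesz

section Euler

variable {E : Type*} [NormedAddCommGroup E] [InnerProductSpace ℝ E] [FiniteDimensional ℝ E]
  [MeasurableSpace E] [BorelSpace E]

/-- The divergence theorem for the radial field `x ↦ ψ x • x`. -/
theorem integral_finrank_mul_add_fderiv_self {ψ : E → ℝ} (hψ : ContDiff ℝ 1 ψ)
    (hc : HasCompactSupport ψ) :
    ∫ x, ((Module.finrank ℝ E : ℝ) * ψ x + fderiv ℝ ψ x x) = 0 := by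
  set b := stdOrthonormalBasis ℝ E
  have hcd : Continuous (fderiv ℝ ψ) := hψ.continuous_fderiv one_ne_zero
  have hψi : Integrable ψ := hψ.continuous.integrable_of_hasCompactSupport hc
  have hcs : ∀ v : E, HasCompactSupport fun x => fderiv ℝ ψ x v := fun v =>
    (hc.fderiv ℝ).comp_left (g := fun L : E →L[ℝ] ℝ => L v) (by simp)
  have hi : ∀ i, Integrable fun x => inner ℝ (b i) x * fderiv ℝ ψ x (b i) := fun i =>
    (Continuous.integrable_of_hasCompactSupport (by fun_prop) (hcs (b i)).mul_left)
  have hfd : ∀ i x, fderiv ℝ (fun x => inner ℝ (b i) x) x (b i) = 1 := fun i x => by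
    have : fderiv ℝ (fun x => inner ℝ (b i) x) x = innerSL ℝ (b i) :=
      (innerSL ℝ (b i)).fderiv
    rw [this]; simp
  have key : ∀ i, ∫ x, inner ℝ (b i) x * fderiv ℝ ψ x (b i) = -∫ x, ψ x := fun i => by
    rw [integral_mul_fderiv_eq_neg_fderiv_mul_of_integrable (by simpa only [hfd, one_mul])
      (hi i) (Continuous.integrable_of_hasCompactSupport (by fun_prop) hc.mul_left)
      (fun x _ => (innerSL ℝ (b i)).differentiableAt)
      (fun x _ => hψ.differentiable one_ne_zero x)]
    simp only [hfd, one_mul]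
  have hsum : ∀ x, fderiv ℝ ψ x x = ∑ i, inner ℝ (b i) x * fderiv ℝ ψ x (b i) := fun x => by
    conv_lhs => rw [← b.sum_repr' x]
    rw [map_sum]
    simp only [map_smul, smul_eq_mul]
    rw [b.sum_repr' x]
  simp only [hsum]
  rw [integral_add (hψi.const_mul _) (integrable_finsetSum _ fun i _ => hi i),
    integral_finsetSum _ fun i _ => hi i, integral_const_mul]
  simp [key]

end Euler

theorem abs_half_log_sq_add_le {t ε : ℝ} (ht : 0 < t) (hε0 : 0 ≤ ε) (hε1 : ε ≤ 1) :
    |log (t ^ 2 + ε) / 2| ≤ t ^ 2 + 1 / t := by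
  have h1 : log (t ^ 2 + ε) ≤ t ^ 2 + ε - 1 := log_le_sub_one_of_pos (by positivity)
  have h2 : log (t ^ 2) ≤ log (t ^ 2 + ε) := log_le_log (by positivity) (by linarith)
  have h3 : log (1 / t) ≤ 1 / t - 1 := log_le_sub_one_of_pos (by positivity)
  rw [log_pow, Nat.cast_ofNat] at h2
  rw [one_div, log_inv, ← one_div] at h3
  have h4 : 0 < 1 / t := by positivity
  rw [abs_le]
  constructor <;> nlinarith [sq_nonneg t]

section

variable {E : Type*} [NormedAddCommGroup E] [InnerProductSpace ℝ E]

theorem abs_inner_div_norm_sq_add_le (x : E) {z : E} (hz : 0 < ‖z‖) {ε : ℝ} (hε : 0 ≤ ε) :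
    |inner ℝ z x / (‖z‖ ^ 2 + ε)| ≤ ‖x‖ / ‖z‖ := by
  rw [abs_div, abs_of_pos (by positivity : 0 < ‖z‖ ^ 2 + ε),
    div_le_div_iff₀ (by positivity) hz]
  calc |inner ℝ z x| * ‖z‖ ≤ (‖z‖ * ‖x‖) * ‖z‖ := by gcongr; exact abs_real_inner_le_norm z x
    _ = ‖x‖ * ‖z‖ ^ 2 := by ring
    _ ≤ _ := by gcongr; linarith

theorem hasCompactSupport_mul_add_fderiv_self {ρ : E → ℝ} (hc : HasCompactSupport ρ) (c : ℝ) :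
    HasCompactSupport fun x => c * ρ x + fderiv ℝ ρ x x := by
  refine hc.mul_left.add ((hc.fderiv ℝ).mono fun x hx h => hx ?_)
  simp [h]

end

section Kernel

variable {E : Type*} [NormedAddCommGroup E] [InnerProductSpace ℝ E] [FiniteDimensional ℝ E]
  [MeasurableSpace E] [BorelSpace E]

theorem ae_prod_fst_ne_snd (hE : 0 < Module.finrank ℝ E) :
    ∀ᵐ p : E × E, p.1 ≠ p.2 := by
  have : Nontrivial E := Module.nontrivial_of_finrank_pos hE
  have hm : MeasurableSet {p : E × E | p.1 = p.2} :=
    measurableSet_eq_fun measurable_fst measurable_snd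
  have h0 : (volume.prod volume) {p : E × E | p.1 = p.2} = 0 := by
    rw [Measure.measure_prod_null hm]
    refine ae_of_all _ fun x => ?_
    have : Prod.mk x ⁻¹' {p : E × E | p.1 = p.2} = {x} := by
      ext y; simp [eq_comm]
    simp [this]
  rw [ae_iff]
  simpa [Measure.volume_eq_prod] using h0

/-- Integration by parts along `x ↦ ρ x • x` against a regularized radial kernel. -/
theorem integral_radial_kernel_by_parts {ρ : E → ℝ} (hρ : ContDiff ℝ 1 ρ)
    (hc : HasCompactSupport ρ) {g : ℝ → ℝ} (hg : ContDiffOn ℝ 1 g (Set.Ioi 0)) (y : E)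
    {ε : ℝ} (hε : 0 < ε) :
    ∫ x, (((Module.finrank ℝ E : ℝ) * ρ x + fderiv ℝ ρ x x) * g (‖x - y‖ ^ 2 + ε) +
      ρ x * (2 * deriv g (‖x - y‖ ^ 2 + ε) * inner ℝ (x - y) x)) = 0 := by
  have hpos : ∀ x, 0 < ‖x - y‖ ^ 2 + ε := fun x => by positivity
  have hk : ContDiff ℝ 1 fun x => g (‖x - y‖ ^ 2 + ε) := by
    rw [← contDiffOn_univ]
    refine hg.comp (t := Set.Ioi 0) (f := fun x => ‖x - y‖ ^ 2 + ε) ?_ fun x _ => hpos x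
    exact (((contDiff_id.sub contDiff_const).norm_sq ℝ).add contDiff_const).contDiffOn
  have hd : ∀ x, fderiv ℝ (fun x => g (‖x - y‖ ^ 2 + ε)) x x =
      2 * deriv g (‖x - y‖ ^ 2 + ε) * inner ℝ (x - y) x := fun x => by
    have h1 : HasDerivAt g (deriv g (‖x - y‖ ^ 2 + ε)) (‖x - y‖ ^ 2 + ε) :=
      ((hg.differentiableOn one_ne_zero).differentiableAt (Ioi_mem_nhds (hpos x))).hasDerivAt
    have h2 := (((hasFDerivAt_id x).sub_const y).norm_sq).add_const ε
    have h3 : HasFDerivAt (fun x => g (‖x - y‖ ^ 2 + ε)) _ x := h1.comp_hasFDerivAt x h2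
    rw [h3.fderiv]
    simp [inner_sub_left]
    ring
  rw [← integral_finrank_mul_add_fderiv_self (hρ.mul hk) hc.mul_right]
  refine integral_congr_ae (ae_of_all _ fun x => ?_)
  simp only []
  rw [fderiv_fun_mul (hρ.differentiable one_ne_zero x) (hk.differentiable one_ne_zero x)]
  simp only [add_apply, smul_apply, smul_eq_mul, hd]
  ring

theorem integrable_continuous_div_norm_sub (hE : 2 ≤ Module.finrank ℝ E) {h : E → ℝ}
    (hh : Continuous h) (hc : HasCompactSupport h) (y : E) :
    Integrable fun x => |h x| / ‖x - y‖ := by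
  have hloc : ∀ R : ℝ, ∃ M : ℝ, ∀ x, ‖x‖ ≤ R → |h x| ≤ M := fun R => by
    obtain ⟨M, hM⟩ := hc.exists_bound_of_continuous hh
    exact ⟨M, fun x _ => hM x⟩
  obtain ⟨C, hC⟩ := riesz_potential_bound (s := 1) zero_le_one
    (by exact_mod_cast hE) (by omega) (hh.integrable_of_hasCompactSupport hc) hloc ‖y‖
  have := (hC y le_rfl).1.norm
  simp only [rpow_one, norm_div, norm_norm, norm_eq_abs (h _)] at this
  simpa only [norm_sub_rev y] using this

theorem tendsto_one_div_succ_add (a : ℝ) :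
    Tendsto (fun m : ℕ => a + 1 / ((m : ℝ) + 1)) atTop (nhds a) := by
  simpa using (tendsto_const_nhds (x := a)).add (tendsto_one_div_add_atTop_nhds_zero_nat (𝕜 := ℝ))

theorem integral_const_sub_log_norm_sub_mul (hE : 2 ≤ Module.finrank ℝ E) {ρ : E → ℝ}
    (hρ : ContDiff ℝ 1 ρ) (hc : HasCompactSupport ρ) (y : E) (a : ℝ) :
    ∫ x, (a - log ‖x - y‖) * ((Module.finrank ℝ E : ℝ) * ρ x + fderiv ℝ ρ x x) =
      ∫ x, ρ x * (inner ℝ (x - y) x / ‖x - y‖ ^ 2) := by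
  have hnt : Nontrivial E := Module.nontrivial_of_finrank_pos (R := ℝ) (by omega)
  set r : E → ℝ := fun x => (Module.finrank ℝ E : ℝ) * ρ x + fderiv ℝ ρ x x with hr
  have hρc : Continuous ρ := hρ.continuous
  have hcd : Continuous (fderiv ℝ ρ) := hρ.continuous_fderiv one_ne_zero
  have hrc : Continuous r := by rw [hr]; fun_prop
  have hrs : HasCompactSupport r := hasCompactSupport_mul_add_fderiv_self hc _
  have hg : ContDiffOn ℝ 1 (fun t : ℝ => log t / 2) (Set.Ioi 0) :=
    (contDiffOn_log.mono fun t ht => (ne_of_gt ht : t ≠ 0)).div_const 2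
  have hgd : ∀ t : ℝ, deriv (fun t : ℝ => log t / 2) t = 1 / t / 2 := fun t => by
    rw [deriv_div_const, deriv_log, one_div]
  have hxy : ∀ᵐ x : E, 0 < ‖x - y‖ := by
    filter_upwards [compl_mem_ae_iff.2 (measure_singleton y)] with x hx
    exact norm_pos_iff.2 (sub_ne_zero.2 hx)
  have hdom : Integrable fun x =>
      (|r x * ‖x - y‖ ^ 2| + |r x| / ‖x - y‖) + |ρ x * ‖x‖| / ‖x - y‖ := by
    refine (Integrable.add ?_ ?_).add ?_
    · exact (Continuous.integrable_of_hasCompactSupport (by fun_prop) hrs.mul_right).abs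
    · exact integrable_continuous_div_norm_sub hE hrc hrs y
    · exact integrable_continuous_div_norm_sub hE (by fun_prop) hc.mul_right y
  have hb1 : ∀ ε : ℝ, 0 ≤ ε → ε ≤ 1 → ∀ x, 0 < ‖x - y‖ →
      ‖r x * (log (‖x - y‖ ^ 2 + ε) / 2)‖ ≤ |r x * ‖x - y‖ ^ 2| + |r x| / ‖x - y‖ :=
    fun ε h0 h1 x hx => by
      rw [norm_mul, norm_eq_abs, norm_eq_abs, abs_mul, abs_of_nonneg (sq_nonneg ‖x - y‖),
        ← mul_one_div |r x|, ← mul_add]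
      gcongr
      exact abs_half_log_sq_add_le hx h0 h1
  have hb2 : ∀ ε : ℝ, 0 ≤ ε → ∀ x, 0 < ‖x - y‖ →
      ‖ρ x * (inner ℝ (x - y) x / (‖x - y‖ ^ 2 + ε))‖ ≤ |ρ x * ‖x‖| / ‖x - y‖ :=
    fun ε h0 x hx => by
      rw [norm_mul, norm_eq_abs, norm_eq_abs, abs_mul, abs_norm, mul_div_assoc]
      gcongr
      exact abs_inner_div_norm_sq_add_le x hx h0
  have hmeas1 : ∀ ε : ℝ, AEStronglyMeasurable
      (fun x => r x * (log (‖x - y‖ ^ 2 + ε) / 2)) volume := fun ε => by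
    refine Measurable.aestronglyMeasurable ?_
    have := hrc.measurable
    fun_prop
  have hmeas2 : ∀ ε : ℝ, AEStronglyMeasurable
      (fun x => ρ x * (inner ℝ (x - y) x / (‖x - y‖ ^ 2 + ε))) volume := fun ε => by
    refine Measurable.aestronglyMeasurable ?_
    have := hρc.measurable
    fun_prop
  have hzero : ∫ x, (r x * (log (‖x - y‖ ^ 2 + 0) / 2) +
      ρ x * (inner ℝ (x - y) x / (‖x - y‖ ^ 2 + 0))) = 0 := by
    have hlim := tendsto_integral_of_dominated_convergence
      (F := fun (m : ℕ) x => r x * (log (‖x - y‖ ^ 2 + 1 / ((m : ℝ) + 1)) / 2) +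
        ρ x * (inner ℝ (x - y) x / (‖x - y‖ ^ 2 + 1 / ((m : ℝ) + 1))))
      (f := fun x => r x * (log (‖x - y‖ ^ 2 + 0) / 2) +
        ρ x * (inner ℝ (x - y) x / (‖x - y‖ ^ 2 + 0))) _
      (fun m => (hmeas1 _).add (hmeas2 _)) hdom (fun m => ?_) ?_
    · refine tendsto_nhds_unique hlim (tendsto_const_nhds.congr fun m => Eq.symm ?_)
      rw [← integral_radial_kernel_by_parts hρ hc hg y (ε := 1 / ((m : ℝ) + 1)) (by positivity)]
      refine integral_congr_ae (ae_of_all _ fun x => ?_)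
      simp only [hgd]
      ring
    · filter_upwards [hxy] with x hx
      have hm1 : 1 / ((m : ℝ) + 1) ≤ 1 := by
        rw [div_le_one (by positivity)]; linarith [(Nat.cast_nonneg m : (0 : ℝ) ≤ m)]
      exact (norm_add_le _ _).trans (add_le_add (hb1 _ (by positivity) hm1 x hx)
        (hb2 _ (by positivity) x hx))
    · filter_upwards [hxy] with x hx
      rw [add_zero]
      have ht := tendsto_one_div_succ_add (‖x - y‖ ^ 2)
      have hne : ‖x - y‖ ^ 2 ≠ 0 := by positivity
      exact (((ht.log hne).div_const 2).const_mul (r x)).add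
        ((tendsto_const_nhds.div ht hne).const_mul (ρ x))
  have hi1 : Integrable fun x => r x * (log (‖x - y‖ ^ 2 + 0) / 2) := by
    refine hdom.mono' (hmeas1 0) ?_
    filter_upwards [hxy] with x hx
    exact (hb1 0 le_rfl zero_le_one x hx).trans (le_add_of_nonneg_right (by positivity))
  have hi2 : Integrable fun x => ρ x * (inner ℝ (x - y) x / (‖x - y‖ ^ 2 + 0)) := by
    refine hdom.mono' (hmeas2 0) ?_
    filter_upwards [hxy] with x hx
    exact (hb2 0 le_rfl x hx).trans (le_add_of_nonneg_left (by positivity))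
  rw [integral_add hi1 hi2] at hzero
  simp only [add_zero, log_pow, Nat.cast_ofNat, mul_div_cancel_left₀ _ (two_ne_zero' ℝ)] at hzero
  have h0 : ∫ x, a * r x = 0 := by
    rw [integral_const_mul, hr, integral_finrank_mul_add_fderiv_self hρ hc, mul_zero]
  simp only [add_zero, log_pow, Nat.cast_ofNat, mul_div_cancel_left₀ _ (two_ne_zero' ℝ)] at hi1
  simp only [sub_mul, mul_comm (log _)]
  rw [integral_sub ((hrc.integrable_of_hasCompactSupport hrs).const_mul a) hi1, h0]
  linarith

end Kernel

theorem exists_forall_lt_norm_eq_zero {E : Type*} [NormedAddCommGroup E] {r : E → ℝ}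
    (hc : HasCompactSupport r) : ∃ R : ℝ, 0 ≤ R ∧ ∀ x, R < ‖x‖ → r x = 0 := by
  obtain ⟨R, hR⟩ := (IsCompact.isBounded hc).subset_closedBall 0
  refine ⟨max R 0, le_max_right _ _, fun x hx => image_eq_zero_of_notMem_tsupport fun h => ?_⟩
  have h1 := mem_closedBall_zero_iff.1 (hR h)
  linarith [le_max_left R 0]

theorem abs_log_div_le {a b t : ℝ} (ha : 0 ≤ a) (hb : 0 ≤ b) (ht : 0 < t) (h1 : a ≤ b + t)
    (h2 : t ≤ a + b) : |log ((a + 1) / t)| ≤ (b + 1) / t + b := by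
  have h3 : log ((a + 1) / t) ≤ (a + 1) / t - 1 := log_le_sub_one_of_pos (by positivity)
  have h4 : log (t / (a + 1)) ≤ t / (a + 1) - 1 := log_le_sub_one_of_pos (by positivity)
  have h5 : (a + 1) / t - 1 ≤ (b + 1) / t := by
    rw [div_sub_one ht.ne']; gcongr; linarith
  have h6 : t / (a + 1) - 1 ≤ b := by
    rw [div_sub_one (by positivity), div_le_iff₀ (by positivity)]; nlinarith
  rw [← inv_div (a + 1) t, log_inv, inv_div] at h4
  have h7 : 0 ≤ (b + 1) / t := by positivity
  rw [abs_le]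
  constructor <;> linarith

section LogPotential

variable {E : Type*} [NormedAddCommGroup E] [InnerProductSpace ℝ E] [FiniteDimensional ℝ E]
  [MeasurableSpace E] [BorelSpace E]

theorem integrable_prod_inner_div (hE : 2 ≤ Module.finrank ℝ E) {w : E → ℝ} (hw : Integrable w)
    (hloc : ∀ R : ℝ, ∃ M : ℝ, ∀ x, ‖x‖ ≤ R → |w x| ≤ M) {r : E → ℝ} (hr : Integrable r) {R : ℝ}
    (hrR : ∀ x, R < ‖x‖ → r x = 0) :
    Integrable fun p : E × E =>
      r p.1 * w p.2 * (inner ℝ (p.1 - p.2) p.1 / ‖p.1 - p.2‖ ^ 2) := by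
  have h1 := ((integrable_prod_riesz (s := 1) zero_le_one (by exact_mod_cast hE) (by omega)
    hw hloc hr hrR).norm).const_mul R
  refine h1.mono' ?_ ?_
  · refine (hr.1.comp_fst.mul hw.1.comp_snd).mul ?_
    exact Measurable.aestronglyMeasurable (by fun_prop)
  · filter_upwards [ae_prod_fst_ne_snd (E := E) (by omega)] with p hp
    by_cases hR : R < ‖p.1‖
    · simp [hrR _ hR]
    · have hpos : 0 < ‖p.1 - p.2‖ := norm_pos_iff.2 (sub_ne_zero.2 hp)
      have h2 := abs_inner_div_norm_sq_add_le p.1 hpos le_rfl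
      rw [add_zero] at h2
      rw [norm_mul, rpow_one, norm_div (r p.1 * w p.2), norm_norm, norm_eq_abs (inner ℝ _ _ / _)]
      calc ‖r p.1 * w p.2‖ * |inner ℝ (p.1 - p.2) p.1 / ‖p.1 - p.2‖ ^ 2|
          ≤ ‖r p.1 * w p.2‖ * (R / ‖p.1 - p.2‖) := by
            gcongr; exact h2.trans (by gcongr; exact not_lt.1 hR)
        _ = _ := by ring

theorem locallyIntegrable_of_integrable_indicator_closedBall {f : E → ℝ}
    (h : ∀ R : ℝ, Integrable ((closedBall (0 : E) R).indicator f)) : LocallyIntegrable f := by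
  refine locallyIntegrable_iff.2 fun k hk => ?_
  obtain ⟨R, hR⟩ := hk.isBounded.subset_closedBall 0
  exact ((integrable_indicator_iff measurableSet_closedBall).1 (h R)).mono_set hR

/-- The radial derivative of a logarithmic potential. -/
theorem fderiv_self_ae_eq_of_log_potential (hE : 2 ≤ Module.finrank ℝ E) {w : E → ℝ}
    (hw : Integrable w) (hloc : ∀ R : ℝ, ∃ M : ℝ, ∀ x, ‖x‖ ≤ R → |w x| ≤ M) {u : E → ℝ}
    (hu : ContDiff ℝ 1 u) {c C : ℝ}
    (hIE : ∀ x, u x = c * (∫ y, log ((‖y‖ + 1) / ‖x - y‖) * w y) + C) :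
    ∀ᵐ x, fderiv ℝ u x x = -c * ∫ y, w y * (inner ℝ (x - y) x / ‖x - y‖ ^ 2) := by
  have hnt : Nontrivial E := Module.nontrivial_of_finrank_pos (R := ℝ) (by omega)
  set H : E → ℝ := fun x => ∫ y, w y * (inner ℝ (x - y) x / ‖x - y‖ ^ 2) with hH
  have hcu : Continuous (fderiv ℝ u) := hu.continuous_fderiv one_ne_zero
  have hHr : ∀ r : E → ℝ, Integrable r → ∀ R : ℝ, (∀ x, R < ‖x‖ → r x = 0) →
      Integrable fun x => r x * H x := fun r hr R hrR => by
    have := (integrable_prod_inner_div hE hw hloc hr hrR).integral_prod_left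
    simpa only [mul_assoc, integral_const_mul] using this
  have hHloc : LocallyIntegrable H := by
    refine locallyIntegrable_of_integrable_indicator_closedBall fun R => ?_
    have := hHr ((closedBall (0 : E) R).indicator fun _ => 1)
      ((integrable_indicator_iff measurableSet_closedBall).2
        (integrableOn_const (isCompact_closedBall (0 : E) R).measure_lt_top.ne)) R
      (fun x hx => Set.indicator_of_notMem (by simpa using hx) _)
    refine this.congr (ae_of_all _ fun x => ?_)
    by_cases hx : x ∈ closedBall (0 : E) R
    · simp only [Set.indicator_of_mem hx, one_mul]
    · simp only [Set.indicator_of_notMem hx, zero_mul]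
  have hDu : Continuous fun x => fderiv ℝ u x x := by fun_prop
  have hsum : LocallyIntegrable fun x => fderiv ℝ u x x + c * H x :=
    (hDu.locallyIntegrable (μ := volume)).add (hHloc.smul c)
  have hmain : ∀ᵐ x, fderiv ℝ u x x + c * H x = 0 := by
    refine ae_eq_zero_of_integral_contDiff_smul_eq_zero hsum fun ρ hρ' hc => ?_
    have hρ : ContDiff ℝ 1 ρ := hρ'.of_le (by exact_mod_cast le_top)
    have hρc := hρ.continuous
    have hcd : Continuous (fderiv ℝ ρ) := hρ.continuous_fderiv one_ne_zero
    set r : E → ℝ := fun x => (Module.finrank ℝ E : ℝ) * ρ x + fderiv ℝ ρ x x with hr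
    have hrc : Continuous r := by rw [hr]; fun_prop
    have hrs : HasCompactSupport r := hasCompactSupport_mul_add_fderiv_self hc _
    have hri : Integrable r := hrc.integrable_of_hasCompactSupport hrs
    have hρi : Integrable ρ := hρc.integrable_of_hasCompactSupport hc
    have hr0 : ∫ x, r x = 0 := integral_finrank_mul_add_fderiv_self hρ hc
    obtain ⟨R, hR0, hrR⟩ := exists_forall_lt_norm_eq_zero hrs
    obtain ⟨R', hR0', hρR⟩ := exists_forall_lt_norm_eq_zero hc
    have hiH := hHr ρ hρi R' hρR
    have hiDu : Integrable fun x => ρ x * fderiv ℝ u x x :=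
      Continuous.integrable_of_hasCompactSupport (by fun_prop) hc.mul_right
    have hiru : Integrable fun x => r x * u x :=
      (hrc.mul hu.continuous).integrable_of_hasCompactSupport hrs.mul_right
    have hparts : (∫ x, r x * u x) + ∫ x, ρ x * fderiv ℝ u x x = 0 := by
      rw [← integral_add hiru hiDu, ← integral_finrank_mul_add_fderiv_self (hρ.mul hu) hc.mul_right]
      refine integral_congr_ae (ae_of_all _ fun x => ?_)
      simp only [hr]
      rw [fderiv_fun_mul (hρ.differentiable one_ne_zero x) (hu.differentiable one_ne_zero x)]
      simp only [add_apply, smul_apply, smul_eq_mul]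
      ring
    have hprod : Integrable fun p : E × E =>
        r p.1 * (log ((‖p.2‖ + 1) / ‖p.1 - p.2‖) * w p.2) := by
      refine (((integrable_prod_riesz (s := 1) zero_le_one (by exact_mod_cast hE) (by omega)
        hw hloc hri hrR).norm.const_mul (R + 1)).add ((hri.mul_prod hw).norm.const_mul R)).mono'
        ?_ ?_
      · refine hri.1.comp_fst.mul (AEStronglyMeasurable.mul ?_ hw.1.comp_snd)
        exact Measurable.aestronglyMeasurable (by fun_prop)
      · filter_upwards [ae_prod_fst_ne_snd (E := E) (by omega)] with p hp
        by_cases hR : R < ‖p.1‖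
        · simp [hrR _ hR]
        have hpos : 0 < ‖p.1 - p.2‖ := norm_pos_iff.2 (sub_ne_zero.2 hp)
        have h3 := abs_log_div_le (norm_nonneg p.2) (norm_nonneg p.1) hpos
          (by linarith [norm_sub_norm_le p.2 p.1, norm_sub_rev p.1 p.2])
          (by linarith [norm_sub_le p.1 p.2])
        have h4 : |log ((‖p.2‖ + 1) / ‖p.1 - p.2‖)| ≤ (R + 1) / ‖p.1 - p.2‖ + R :=
          h3.trans (by gcongr <;> exact not_lt.1 hR)
        simp only [Pi.add_apply, norm_mul, norm_div, rpow_one, norm_norm,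
          norm_eq_abs (log _)]
        calc ‖r p.1‖ * (|log ((‖p.2‖ + 1) / ‖p.1 - p.2‖)| * ‖w p.2‖)
            ≤ ‖r p.1‖ * (((R + 1) / ‖p.1 - p.2‖ + R) * ‖w p.2‖) := by gcongr
          _ = _ := by ring
    have hinner : ∀ y, ∫ x, r x * (log ((‖y‖ + 1) / ‖x - y‖) * w y) =
        ∫ x, ρ x * w y * (inner ℝ (x - y) x / ‖x - y‖ ^ 2) := fun y => by
      have h1 := integral_const_sub_log_norm_sub_mul hE hρ hc y (log (‖y‖ + 1))
      calc ∫ x, r x * (log ((‖y‖ + 1) / ‖x - y‖) * w y)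
          = ∫ x, w y * ((log (‖y‖ + 1) - log ‖x - y‖) * r x) := by
            refine integral_congr_ae ?_
            filter_upwards [compl_mem_ae_iff.2 (measure_singleton y)] with x hx
            have hx' : ‖x - y‖ ≠ 0 := norm_ne_zero_iff.2 (sub_ne_zero.2 hx)
            rw [log_div (by positivity) hx']
            ring
        _ = w y * ∫ x, ρ x * (inner ℝ (x - y) x / ‖x - y‖ ^ 2) := by
            rw [integral_const_mul, h1]
        _ = _ := by
            rw [← integral_const_mul]
            refine integral_congr_ae (ae_of_all _ fun x => ?_)
            simp only []
            ring
    have hru : ∫ x, r x * u x = c * ∫ x, ρ x * H x := by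
      calc ∫ x, r x * u x
          = ∫ x, (c * (∫ y, r x * (log ((‖y‖ + 1) / ‖x - y‖) * w y)) + C * r x) := by
            refine integral_congr_ae (ae_of_all _ fun x => ?_)
            simp only [integral_const_mul]
            rw [hIE x]; ring
        _ = c * ∫ x, ∫ y, r x * (log ((‖y‖ + 1) / ‖x - y‖) * w y) := by
            rw [integral_add (hprod.integral_prod_left.const_mul c) (hri.const_mul C),
              integral_const_mul, integral_const_mul, hr0, mul_zero, add_zero]
        _ = c * ∫ y, ∫ x, r x * (log ((‖y‖ + 1) / ‖x - y‖) * w y) := by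
            rw [integral_integral_swap hprod]
        _ = c * ∫ y, ∫ x, ρ x * w y * (inner ℝ (x - y) x / ‖x - y‖ ^ 2) := by
            simp only [hinner]
        _ = c * ∫ x, ∫ y, ρ x * w y * (inner ℝ (x - y) x / ‖x - y‖ ^ 2) := by
            rw [← integral_integral_swap (integrable_prod_inner_div hE hw hloc hρi hρR)]
        _ = _ := by simp only [mul_assoc, integral_const_mul, hH]
    calc ∫ x, ρ x • (fderiv ℝ u x x + c * H x)
        = ∫ x, (ρ x * fderiv ℝ u x x + c * (ρ x * H x)) := by
          refine integral_congr_ae (ae_of_all _ fun x => ?_)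
          simp only [smul_eq_mul]
          ring
      _ = 0 := by
          rw [integral_add hiDu (hiH.const_mul c), integral_const_mul]
          linarith
  filter_upwards [hmain] with x hx
  linarith

end LogPotential

theorem norm_sq_rpow_neg_half {E : Type*} [NormedAddCommGroup E] {z : E} (μ : ℝ) :
    (‖z‖ ^ 2) ^ (-μ / 2) = 1 / ‖z‖ ^ μ := by
  rw [← rpow_natCast, ← rpow_mul (norm_nonneg z), one_div, ← rpow_neg (norm_nonneg z)]
  congr 1
  push_cast
  ring

section Energy

variable {E : Type*} [NormedAddCommGroup E] [InnerProductSpace ℝ E] [FiniteDimensional ℝ E]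
  [MeasurableSpace E] [BorelSpace E]

theorem integral_regularized_energy_variation {μ : ℝ} (hμ0 : 0 < μ) {F : E → ℝ}
    (hF : ContDiff ℝ 1 F) (hFi : Integrable F) {φ : E → ℝ} (hφ : ContDiff ℝ 1 φ)
    (hc : HasCompactSupport φ) {ε : ℝ} (hε : 0 < ε) (hε1 : ε ≤ 1) :
    ∫ p : E × E, (((Module.finrank ℝ E : ℝ) * (φ p.1 * F p.1) +
        fderiv ℝ (fun x => φ x * F x) p.1 p.1) * F p.2 * (‖p.1 - p.2‖ ^ 2 + ε) ^ (-μ / 2) -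
      μ / 2 * (F p.1 * F p.2 * (‖p.1 - p.2‖ ^ 2 + ε) ^ (-μ / 2) *
        (inner ℝ (p.1 - p.2) (φ p.1 • p.1 - φ p.2 • p.2) / (‖p.1 - p.2‖ ^ 2 + ε)))) = 0 := by
  set ρ : E → ℝ := fun x => φ x * F x with hρdef
  have hρ : ContDiff ℝ 1 ρ := hφ.mul hF
  have hρs : HasCompactSupport ρ := hc.mul_right
  have hρc := hρ.continuous
  have hcd : Continuous (fderiv ℝ ρ) := hρ.continuous_fderiv one_ne_zero
  have hFc := hF.continuous
  have hφc := hφ.continuous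
  set r : E → ℝ := fun x => (Module.finrank ℝ E : ℝ) * ρ x + fderiv ℝ ρ x x with hr
  have hrc : Continuous r := by rw [hr]; fun_prop
  have hrs : HasCompactSupport r := hasCompactSupport_mul_add_fderiv_self hρs _
  have hri : Integrable r := hrc.integrable_of_hasCompactSupport hrs
  have hpos : ∀ p : E × E, 0 < ‖p.1 - p.2‖ ^ 2 + ε := fun p => by positivity
  have hkle : ∀ p : E × E, (‖p.1 - p.2‖ ^ 2 + ε) ^ (-μ / 2) ≤ ε ^ (-μ / 2) := fun p =>
    rpow_le_rpow_of_nonpos hε (by nlinarith [sq_nonneg ‖p.1 - p.2‖]) (by linarith)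
  have hkc : Continuous fun p : E × E => (‖p.1 - p.2‖ ^ 2 + ε) ^ (-μ / 2) :=
    Continuous.rpow_const (by fun_prop) fun p => Or.inl (hpos p).ne'
  set A : E × E → ℝ := fun p => r p.1 * F p.2 * (‖p.1 - p.2‖ ^ 2 + ε) ^ (-μ / 2) with hA
  set B : E × E → ℝ := fun p => -μ * (F p.2 * ρ p.1 * (‖p.1 - p.2‖ ^ 2 + ε) ^ (-μ / 2) *
    (inner ℝ (p.1 - p.2) p.1 / (‖p.1 - p.2‖ ^ 2 + ε))) with hB
  have hAi : Integrable A := by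
    refine ((hri.mul_prod hFi).norm.mul_const (ε ^ (-μ / 2))).mono' ?_ (ae_of_all _ fun p => ?_)
    · exact Continuous.aestronglyMeasurable (by fun_prop)
    · simp only [hA]
      rw [norm_mul (r p.1 * F p.2), norm_eq_abs (_ ^ _), abs_of_nonneg (rpow_nonneg (hpos p).le _)]
      exact mul_le_mul_of_nonneg_left (hkle p) (norm_nonneg _)
  have hBi : Integrable B := by
    have h1 : Integrable fun x => ρ x * ‖x‖ :=
      Continuous.integrable_of_hasCompactSupport (by fun_prop) hρs.mul_right
    refine ((h1.mul_prod hFi).norm.const_mul (μ * (ε ^ (-μ / 2) * ε⁻¹))).mono' ?_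
      (ae_of_all _ fun p => ?_)
    · have hp := fun p => (hpos p).ne'
      refine Continuous.aestronglyMeasurable ?_
      simp only [hB]
      fun_prop (disch := exact hp _)
    · have h2 : |inner ℝ (p.1 - p.2) p.1 / (‖p.1 - p.2‖ ^ 2 + ε)| ≤ ε⁻¹ * ‖p.1‖ := by
        rw [abs_div, abs_of_pos (hpos p), div_le_iff₀ (hpos p)]
        refine (abs_real_inner_le_norm _ _).trans ?_
        have h3 : ‖p.1 - p.2‖ ≤ ε⁻¹ * (‖p.1 - p.2‖ ^ 2 + ε) := by
          rw [mul_add, inv_mul_cancel₀ hε.ne']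
          have : 1 ≤ ε⁻¹ := (one_le_inv₀ hε).2 hε1
          nlinarith [sq_nonneg (‖p.1 - p.2‖ - 1), sq_nonneg ‖p.1 - p.2‖]
        calc ‖p.1 - p.2‖ * ‖p.1‖ ≤ (ε⁻¹ * (‖p.1 - p.2‖ ^ 2 + ε)) * ‖p.1‖ := by gcongr
          _ = _ := by ring
      simp only [hB]
      rw [norm_mul, norm_neg, norm_mul, norm_mul, norm_mul (F p.2), norm_eq_abs μ, abs_of_pos hμ0,
        norm_eq_abs (_ ^ _), abs_of_nonneg (rpow_nonneg (hpos p).le _), norm_eq_abs (_ / _),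
        norm_mul (_ * _) (F p.2), norm_mul (ρ p.1), norm_norm]
      have h3 := rpow_nonneg hε.le (-μ / 2)
      calc μ * (‖F p.2‖ * ‖ρ p.1‖ * (‖p.1 - p.2‖ ^ 2 + ε) ^ (-μ / 2) *
            |inner ℝ (p.1 - p.2) p.1 / (‖p.1 - p.2‖ ^ 2 + ε)|)
          ≤ μ * (‖F p.2‖ * ‖ρ p.1‖ * ε ^ (-μ / 2) * (ε⁻¹ * ‖p.1‖)) := by
            refine mul_le_mul_of_nonneg_left (mul_le_mul ?_ h2 (abs_nonneg _) (by positivity))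
              hμ0.le
            exact mul_le_mul_of_nonneg_left (hkle p) (by positivity)
        _ = _ := by ring
  have hg : ContDiffOn ℝ 1 (fun t : ℝ => t ^ (-μ / 2)) (Set.Ioi 0) := fun t ht =>
    (contDiffAt_rpow_const_of_ne (ne_of_gt ht)).contDiffWithinAt
  have hAB : ∫ p, (A p + B p) = 0 := by
    have hABi : Integrable (fun p => A p + B p) (volume.prod volume) := hAi.add hBi
    rw [Measure.volume_eq_prod, integral_prod_symm _ hABi]
    have h0 : ∀ y, ∫ x, (A (x, y) + B (x, y)) = 0 := fun y => by
      have h1 := integral_radial_kernel_by_parts hρ hρs hg y hε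
      have h2 : ∀ x, A (x, y) + B (x, y) = F y * (r x * (‖x - y‖ ^ 2 + ε) ^ (-μ / 2) +
          ρ x * (2 * deriv (fun t : ℝ => t ^ (-μ / 2)) (‖x - y‖ ^ 2 + ε) *
            inner ℝ (x - y) x)) := fun x => by
        have hp := hpos (x, y)
        simp only [hA, hB]
        rw [Real.deriv_rpow_const, rpow_sub_one hp.ne']
        ring
      simp only [h2]
      rw [integral_const_mul, h1, mul_zero]
    simp only [h0, integral_zero]
  have hswap : ∫ p : E × E, B p.swap = ∫ p, B p := integral_prod_swap B
  have hBs : Integrable fun p : E × E => B p.swap := hBi.swap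
  calc _ = ∫ p : E × E, (A p + (1 / 2) * (B p + B p.swap)) := by
        refine integral_congr_ae (ae_of_all _ fun p => ?_)
        simp only [hA, hB, hρdef, hr, Prod.fst_swap, Prod.snd_swap]
        rw [norm_sub_rev p.2 p.1, ← neg_sub p.1 p.2, inner_neg_left, inner_sub_right,
          inner_smul_right, inner_smul_right]
        ring
    _ = 0 := by
        rw [integral_add hAi hBi] at hAB
        have hBB : Integrable fun p : E × E => 1 / 2 * (B p + B p.swap) :=
          (hBi.add hBs).const_mul _
        rw [integral_add hAi hBB, integral_const_mul, integral_add hBi hBs, hswap]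
        linarith

/-- First variation of the energy `∬ F x * F y / ‖x - y‖ ^ μ` along the field `x ↦ φ x • x`. -/
theorem integral_energy_variation {μ : ℝ} (hμ0 : 0 < μ) (hμ : μ < Module.finrank ℝ E) {F : E → ℝ}
    (hF : ContDiff ℝ 1 F) (hFi : Integrable F)
    (hK : Integrable fun p : E × E => F p.1 * F p.2 / ‖p.1 - p.2‖ ^ μ)
    (hloc : ∀ R : ℝ, ∃ M : ℝ, ∀ x, ‖x‖ ≤ R → |F x| ≤ M) {φ : E → ℝ} (hφ : ContDiff ℝ 1 φ)
    (hc : HasCompactSupport φ) {L : ℝ}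
    (hL : ∀ x y, |inner ℝ (x - y) (φ x • x - φ y • y)| ≤ L * ‖x - y‖ ^ 2) :
    ∫ p : E × E, (((Module.finrank ℝ E : ℝ) * (φ p.1 * F p.1) +
        fderiv ℝ (fun x => φ x * F x) p.1 p.1) * F p.2 / ‖p.1 - p.2‖ ^ μ -
      μ / 2 * (F p.1 * F p.2 / ‖p.1 - p.2‖ ^ μ *
        (inner ℝ (p.1 - p.2) (φ p.1 • p.1 - φ p.2 • p.2) / ‖p.1 - p.2‖ ^ 2))) = 0 := by
  have hE : 0 < Module.finrank ℝ E := by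
    have : (0 : ℝ) < Module.finrank ℝ E := hμ0.trans hμ
    exact_mod_cast this
  have hnt : Nontrivial E := Module.nontrivial_of_finrank_pos hE
  have hL0 : 0 ≤ L := by
    obtain ⟨x, hx⟩ := exists_ne (0 : E)
    have h1 := (abs_nonneg _).trans (hL x 0)
    rw [sub_zero] at h1
    exact nonneg_of_mul_nonneg_left h1 (by positivity)
  set ρ : E → ℝ := fun x => φ x * F x with hρdef
  have hρ : ContDiff ℝ 1 ρ := hφ.mul hF
  have hρs : HasCompactSupport ρ := hc.mul_right
  have hρc := hρ.continuous
  have hcd : Continuous (fderiv ℝ ρ) := hρ.continuous_fderiv one_ne_zero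
  have hFc := hF.continuous
  have hφc := hφ.continuous
  set r : E → ℝ := fun x => (Module.finrank ℝ E : ℝ) * ρ x + fderiv ℝ ρ x x with hr
  have hrc : Continuous r := by rw [hr]; fun_prop
  have hrs : HasCompactSupport r := hasCompactSupport_mul_add_fderiv_self hρs _
  have hri : Integrable r := hrc.integrable_of_hasCompactSupport hrs
  obtain ⟨R, hR0, hrR⟩ := exists_forall_lt_norm_eq_zero hrs
  have hdom : Integrable fun p : E × E => ‖r p.1 * F p.2 / ‖p.1 - p.2‖ ^ μ‖ +
      μ / 2 * (‖F p.1 * F p.2 / ‖p.1 - p.2‖ ^ μ‖ * L) :=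
    (integrable_prod_riesz hμ0.le hμ hE hFi hloc hri hrR).norm.add
      ((hK.norm.mul_const L).const_mul _)
  refine tendsto_nhds_unique (tendsto_integral_of_dominated_convergence
    (F := fun (m : ℕ) p => r p.1 * F p.2 * (‖p.1 - p.2‖ ^ 2 + 1 / ((m : ℝ) + 1)) ^ (-μ / 2) -
      μ / 2 * (F p.1 * F p.2 * (‖p.1 - p.2‖ ^ 2 + 1 / ((m : ℝ) + 1)) ^ (-μ / 2) *
        (inner ℝ (p.1 - p.2) (φ p.1 • p.1 - φ p.2 • p.2) /
          (‖p.1 - p.2‖ ^ 2 + 1 / ((m : ℝ) + 1))))) _ (fun m => ?_) hdom (fun m => ?_) ?_)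
    (tendsto_const_nhds.congr fun m => (integral_regularized_energy_variation hμ0 hF hFi hφ hc
      (ε := 1 / ((m : ℝ) + 1)) (by positivity) ?_).symm)
  · have hrm := hrc.measurable
    have hFm := hFc.measurable
    have hφm := hφc.measurable
    exact Measurable.aestronglyMeasurable (by fun_prop)
  · filter_upwards [ae_prod_fst_ne_snd (E := E) hE] with p hp
    have hz : 0 < ‖p.1 - p.2‖ := norm_pos_iff.2 (sub_ne_zero.2 hp)
    have hm : 0 < 1 / ((m : ℝ) + 1) := by positivity
    have ht : 0 < ‖p.1 - p.2‖ ^ 2 + 1 / ((m : ℝ) + 1) := by positivity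
    have hk : (‖p.1 - p.2‖ ^ 2 + 1 / ((m : ℝ) + 1)) ^ (-μ / 2) ≤ 1 / ‖p.1 - p.2‖ ^ μ := by
      rw [← norm_sq_rpow_neg_half]
      exact rpow_le_rpow_of_nonpos (by positivity) (by linarith) (by linarith)
    have hi : |inner ℝ (p.1 - p.2) (φ p.1 • p.1 - φ p.2 • p.2) /
        (‖p.1 - p.2‖ ^ 2 + 1 / ((m : ℝ) + 1))| ≤ L := by
      rw [abs_div, abs_of_pos ht, div_le_iff₀ ht]
      exact (hL _ _).trans (by gcongr; linarith)
    have hk0 := rpow_nonneg ht.le (-μ / 2)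
    have hk1 : (0 : ℝ) ≤ ‖p.1 - p.2‖ ^ μ := rpow_nonneg hz.le μ
    refine (norm_sub_le _ _).trans (add_le_add ?_ ?_)
    · rw [norm_mul, norm_div, norm_eq_abs (_ ^ (-μ / 2)), norm_eq_abs (_ ^ μ), abs_of_nonneg hk0,
        abs_of_nonneg hk1, ← mul_one_div ‖r p.1 * F p.2‖]
      gcongr
    · rw [norm_mul (μ / 2), norm_mul (_ * _), norm_mul (_ * _), norm_div (_ * _),
        norm_eq_abs (_ ^ (-μ / 2)), norm_eq_abs (_ ^ μ),
        abs_of_nonneg hk0, abs_of_nonneg hk1, norm_eq_abs (μ / 2), abs_of_pos (by positivity),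
        norm_eq_abs (_ / _), ← mul_one_div ‖F p.1 * F p.2‖]
      gcongr
  · filter_upwards [ae_prod_fst_ne_snd (E := E) hE] with p hp
    have hz : 0 < ‖p.1 - p.2‖ := norm_pos_iff.2 (sub_ne_zero.2 hp)
    have ht := tendsto_one_div_succ_add (‖p.1 - p.2‖ ^ 2)
    have hne : ‖p.1 - p.2‖ ^ 2 ≠ 0 := by positivity
    have hk := ht.rpow_const (p := -μ / 2) (Or.inl hne)
    rw [norm_sq_rpow_neg_half] at hk
    have h1 := hk.const_mul (r p.1 * F p.2)
    have h2 := ((hk.const_mul (F p.1 * F p.2)).mul ((tendsto_const_nhds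
      (x := (inner ℝ (p.1 - p.2) (φ p.1 • p.1 - φ p.2 • p.2) : ℝ))).div ht hne)).const_mul (μ / 2)
    have h3 := h1.sub h2
    rw [mul_one_div, mul_one_div] at h3
    exact h3
  · rw [div_le_one (by positivity)]; linarith [(Nat.cast_nonneg m : (0 : ℝ) ≤ m)]

end Energy

section Pohozaev

variable {E : Type*} [NormedAddCommGroup E] [InnerProductSpace ℝ E] [FiniteDimensional ℝ E]

/-- Cutoffs at scale `m + 1` whose radial vector fields are uniformly Lipschitz. -/
theorem exists_radial_cutoffs : ∃ φ : ℕ → E → ℝ, ∃ L M : ℝ,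
    (∀ m, ContDiff ℝ 1 (φ m)) ∧ (∀ m, HasCompactSupport (φ m)) ∧
    (∀ m x y, |inner ℝ (x - y) (φ m x • x - φ m y • y)| ≤ L * ‖x - y‖ ^ 2) ∧
    (∀ m x, |φ m x| ≤ 1) ∧ (∀ m x, |fderiv ℝ (φ m) x x| ≤ M) ∧
    ∀ x, ∀ᶠ m in atTop, φ m x = 1 ∧ fderiv ℝ (φ m) x x = 0 := by
  let χ : ContDiffBump (0 : E) := ⟨1, 2, one_pos, one_lt_two⟩
  have hχ : ContDiff ℝ 1 χ := χ.contDiff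
  have hχs : HasCompactSupport χ := χ.hasCompactSupport
  have hX : ContDiff ℝ 1 fun x => χ x • x := hχ.smul contDiff_id
  have hXs : HasCompactSupport fun x => χ x • x := hχs.smul_right
  obtain ⟨L, hL⟩ := hX.lipschitzWith_of_hasCompactSupport hXs one_ne_zero
  have hcd : Continuous (fderiv ℝ χ) := hχ.continuous_fderiv one_ne_zero
  obtain ⟨M, hM⟩ := Continuous.bounded_above_of_compact_support
    (f := fun x => fderiv ℝ χ x x) (by fun_prop) (by
      refine (hχs.fderiv (𝕜 := ℝ)).mono fun x hx h => hx ?_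
      simp [h])
  have hm : ∀ m : ℕ, (0 : ℝ) < (m : ℝ) + 1 := fun m => by positivity
  have hfd : ∀ (m : ℕ) (x : E), fderiv ℝ (fun x => χ (((m : ℝ) + 1)⁻¹ • x)) x x =
      fderiv ℝ χ (((m : ℝ) + 1)⁻¹ • x) (((m : ℝ) + 1)⁻¹ • x) := fun m x => by
    have h1 : HasFDerivAt χ (fderiv ℝ χ (((m : ℝ) + 1)⁻¹ • x)) (((m : ℝ) + 1)⁻¹ • x) :=
      (hχ.differentiable one_ne_zero _).hasFDerivAt
    have h2 := h1.comp x ((hasFDerivAt_id x).const_smul ((m : ℝ) + 1)⁻¹)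
    have h3 := h2.fderiv
    have h4 := congrArg (fun T : E →L[ℝ] ℝ => T x) h3
    exact h4
  refine ⟨fun m x => χ (((m : ℝ) + 1)⁻¹ • x), L, M, fun m => by fun_prop, fun m => ?_,
    fun m x y => ?_, fun m x => ?_, fun m x => ?_, fun x => ?_⟩
  · exact hχs.comp_smul (inv_ne_zero (hm m).ne')
  · refine (abs_real_inner_le_norm _ _).trans ?_
    have h1 : ∀ x : E, χ (((m : ℝ) + 1)⁻¹ • x) • x = ((m : ℝ) + 1) •
        (χ (((m : ℝ) + 1)⁻¹ • x) • ((m : ℝ) + 1)⁻¹ • x) := fun x => by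
      rw [smul_comm, smul_inv_smul₀ (hm m).ne']
    have h2 := hL.norm_sub_le (((m : ℝ) + 1)⁻¹ • x) (((m : ℝ) + 1)⁻¹ • y)
    rw [← smul_sub, norm_smul ((m : ℝ) + 1)⁻¹, norm_inv, norm_of_nonneg (hm m).le] at h2
    have h3 : ‖χ (((m : ℝ) + 1)⁻¹ • x) • x - χ (((m : ℝ) + 1)⁻¹ • y) • y‖ ≤ L * ‖x - y‖ := by
      rw [h1, h1 y, ← smul_sub, norm_smul, norm_of_nonneg (hm m).le]
      refine (mul_le_mul_of_nonneg_left h2 (hm m).le).trans (le_of_eq ?_)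
      have := (hm m).ne'
      field_simp
    calc _ ≤ ‖x - y‖ * (L * ‖x - y‖) := mul_le_mul_of_nonneg_left h3 (norm_nonneg _)
      _ = _ := by ring
  · rw [abs_of_nonneg χ.nonneg]; exact χ.le_one
  · rw [hfd]; exact hM _
  · have h1 : Tendsto (fun m : ℕ => ((m : ℝ) + 1)⁻¹ • x) atTop (nhds ((0 : ℝ) • x)) := by
      have := tendsto_one_div_add_atTop_nhds_zero_nat (𝕜 := ℝ)
      simp only [one_div] at this
      exact this.smul_const x
    rw [zero_smul] at h1
    filter_upwards [h1.eventually_mem (ball_mem_nhds (0 : E) one_pos)] with m hmx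
    have h2 := χ.eventuallyEq_one_of_mem_ball hmx
    refine ⟨h2.eq_of_nhds, ?_⟩
    rw [hfd, h2.fderiv_eq]
    simp

variable [MeasurableSpace E] [BorelSpace E]

/-- The localized Pohozaev identity for the integral equation. -/
theorem integral_virial_of_log_potential {μ q c : ℝ} (hμ0 : 0 < μ) (hμ : μ < Module.finrank ℝ E)
    (hE : 2 ≤ Module.finrank ℝ E) {u : E → ℝ} (hu : ContDiff ℝ 1 u) {F w : E → ℝ}
    (hFu : ∀ x, F x = exp (q * u x)) (hFi : Integrable F)
    (hK : Integrable fun p : E × E => F p.1 * F p.2 / ‖p.1 - p.2‖ ^ μ)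
    (hFloc : ∀ R : ℝ, ∃ M : ℝ, ∀ x, ‖x‖ ≤ R → |F x| ≤ M)
    (hwF : ∀ x, w x = (∫ y, F y / ‖x - y‖ ^ μ) * F x) (hw : Integrable w)
    (hwloc : ∀ R : ℝ, ∃ M : ℝ, ∀ x, ‖x‖ ≤ R → |w x| ≤ M)
    (hfd : ∀ᵐ x, fderiv ℝ u x x = -c * ∫ y, w y * (inner ℝ (x - y) x / ‖x - y‖ ^ 2))
    {φ : E → ℝ} (hφ : ContDiff ℝ 1 φ) (hc : HasCompactSupport φ) {L : ℝ}
    (hL : ∀ x y, |inner ℝ (x - y) (φ x • x - φ y • y)| ≤ L * ‖x - y‖ ^ 2) :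
    ∫ p : E × E, (((Module.finrank ℝ E * φ p.1 + fderiv ℝ φ p.1 p.1) -
        μ / 2 * (inner ℝ (p.1 - p.2) (φ p.1 • p.1 - φ p.2 • p.2) / ‖p.1 - p.2‖ ^ 2)) *
        (F p.1 * F p.2 / ‖p.1 - p.2‖ ^ μ) - q * c / 2 * (w p.1 * w p.2 *
        (inner ℝ (p.1 - p.2) (φ p.1 • p.1 - φ p.2 • p.2) / ‖p.1 - p.2‖ ^ 2))) = 0 := by
  have hFeq : F = fun x => exp (q * u x) := funext hFu
  have hF : ContDiff ℝ 1 F := by rw [hFeq]; fun_prop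
  have hFc := hF.continuous
  have hφc := hφ.continuous
  have hcdφ : Continuous (fderiv ℝ φ) := hφ.continuous_fderiv one_ne_zero
  have hcdu : Continuous (fderiv ℝ u) := hu.continuous_fderiv one_ne_zero
  have hmain := integral_energy_variation hμ0 hμ hF hFi hK hFloc hφ hc hL
  have hfdF : ∀ x, fderiv ℝ (fun x => φ x * F x) x x =
      fderiv ℝ φ x x * F x + φ x * (q * F x * fderiv ℝ u x x) := fun x => by
    have h1 : HasFDerivAt φ (fderiv ℝ φ x) x := (hφ.differentiable one_ne_zero _).hasFDerivAt
    have h2 : HasFDerivAt u (fderiv ℝ u x) x := (hu.differentiable one_ne_zero _).hasFDerivAt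
    have h3 : HasFDerivAt F (exp (q * u x) • q • fderiv ℝ u x) x := by
      rw [hFeq]; exact (h2.const_mul q).exp
    have h4 := congrArg (fun T : E →L[ℝ] ℝ => T x) (h1.mul h3).fderiv
    refine h4.trans ?_
    simp only [add_apply, smul_apply, smul_eq_mul, hFu]
    ring
  obtain ⟨R, hR0, hφR⟩ := exists_forall_lt_norm_eq_zero hc
  set J : E × E → ℝ := fun p =>
    inner ℝ (p.1 - p.2) (φ p.1 • p.1 - φ p.2 • p.2) / ‖p.1 - p.2‖ ^ 2 with hJ
  set A : E × E → ℝ := fun p => ((Module.finrank ℝ E * φ p.1 + fderiv ℝ φ p.1 p.1) * F p.1) *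
    F p.2 / ‖p.1 - p.2‖ ^ μ with hA
  set T : E × E → ℝ := fun p => (φ p.1 * (q * F p.1 * fderiv ℝ u p.1 p.1)) *
    F p.2 / ‖p.1 - p.2‖ ^ μ with hT
  set S : E × E → ℝ := fun p => μ / 2 * (F p.1 * F p.2 / ‖p.1 - p.2‖ ^ μ * J p) with hS
  set G : E × E → ℝ := fun p =>
    (φ p.1 * w p.1) * w p.2 * (inner ℝ (p.1 - p.2) p.1 / ‖p.1 - p.2‖ ^ 2) with hG
  have hAi : Integrable A := by
    obtain ⟨R', -, hR'⟩ := exists_forall_lt_norm_eq_zero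
      (hasCompactSupport_mul_add_fderiv_self hc (Module.finrank ℝ E : ℝ))
    refine integrable_prod_riesz
      (r := fun x => (Module.finrank ℝ E * φ x + fderiv ℝ φ x x) * F x)
      hμ0.le hμ (by omega) hFi hFloc (Continuous.integrable_of_hasCompactSupport (by fun_prop)
        (hasCompactSupport_mul_add_fderiv_self hc (Module.finrank ℝ E : ℝ)).mul_right) (R := R')
      fun x hx => ?_
    simp only [hR' x hx, zero_mul]
  have hTi : Integrable T :=
    integrable_prod_riesz (r := fun x => φ x * (q * F x * fderiv ℝ u x x))
      hμ0.le hμ (by omega) hFi hFloc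
      (Continuous.integrable_of_hasCompactSupport (by fun_prop) hc.mul_right) (R := R)
      fun x hx => by simp only [hφR x hx, zero_mul]
  have hJm : Measurable J := by
    have := hφc.measurable
    rw [hJ]
    fun_prop
  have hSi : Integrable S := by
    refine ((hK.norm.mul_const L).const_mul (μ / 2)).mono' ?_ ?_
    · exact (hK.1.mul hJm.aestronglyMeasurable).const_mul _
    · filter_upwards [ae_prod_fst_ne_snd (E := E) (by omega)] with p hp
      have hz : 0 < ‖p.1 - p.2‖ := norm_pos_iff.2 (sub_ne_zero.2 hp)
      have h1 : ‖J p‖ ≤ L := by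
        rw [norm_eq_abs, hJ, abs_div, abs_of_pos (by positivity : 0 < ‖p.1 - p.2‖ ^ 2),
          div_le_iff₀ (by positivity)]
        exact hL _ _
      rw [hS, norm_mul, norm_mul (_ / _), norm_of_nonneg (by positivity : (0 : ℝ) ≤ μ / 2)]
      gcongr
  have hφw : Integrable fun x => φ x * w x :=
    hw.bdd_mul hφc.aestronglyMeasurable
      (ae_of_all _ (hφc.bounded_above_of_compact_support hc).choose_spec)
  have hGi : Integrable G := integrable_prod_inner_div hE hw hwloc hφw (R := R)
    fun x hx => by rw [hφR x hx, zero_mul]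
  have hGs : Integrable fun p : E × E => G p.swap := hGi.swap
  have hTG : ∫ p, T p = -(q * c) * ∫ p, G p := by
    have h1 : ∫ p, T p = ∫ x, ∫ y, T (x, y) := integral_prod T hTi
    have h2 : ∫ p, G p = ∫ x, ∫ y, G (x, y) := integral_prod G hGi
    rw [h1, h2, ← integral_const_mul]
    refine integral_congr_ae ?_
    filter_upwards [hfd] with x hx
    simp only [hT, hG, mul_div_assoc, mul_assoc, integral_const_mul]
    rw [hx, hwF x]
    ring
  have hswap : ∫ p : E × E, G p.swap = ∫ p, G p := integral_prod_swap G
  have hGG : Integrable fun p : E × E => q * c / 2 * (G p + G p.swap) :=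
    (hGi.add hGs).const_mul _
  have hAS : Integrable fun p : E × E => A p - S p := hAi.sub hSi
  have h0 : ∫ p, (A p - S p + T p) = 0 := by
    refine Eq.trans (integral_congr_ae (ae_of_all _ fun p => ?_)) hmain
    simp only [hA, hS, hT, hfdF]
    ring
  rw [integral_add hAS hTi, hTG] at h0
  calc _ = ∫ p : E × E, (A p - S p - q * c / 2 * (G p + G p.swap)) := by
        refine integral_congr_ae (ae_of_all _ fun p => ?_)
        simp only [hA, hS, hG, hJ, Prod.fst_swap, Prod.snd_swap]
        rw [norm_sub_rev p.2 p.1, ← neg_sub p.1 p.2, inner_neg_left, inner_sub_right,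
          inner_smul_right, inner_smul_right]
        ring
    _ = 0 := by
        rw [integral_sub hAS hGG, integral_const_mul, integral_add hGi hGs, hswap]
        linarith

/-- The Pohozaev identity for the integral equation. -/
theorem virial_identity_of_log_potential {μ q c : ℝ} (hμ0 : 0 < μ) (hμ : μ < Module.finrank ℝ E)
    (hE : 2 ≤ Module.finrank ℝ E) {u : E → ℝ} (hu : ContDiff ℝ 1 u) {F w : E → ℝ}
    (hFu : ∀ x, F x = exp (q * u x)) (hFi : Integrable F)
    (hK : Integrable fun p : E × E => F p.1 * F p.2 / ‖p.1 - p.2‖ ^ μ)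
    (hFloc : ∀ R : ℝ, ∃ M : ℝ, ∀ x, ‖x‖ ≤ R → |F x| ≤ M)
    (hwF : ∀ x, w x = (∫ y, F y / ‖x - y‖ ^ μ) * F x) (hw : Integrable w)
    (hwloc : ∀ R : ℝ, ∃ M : ℝ, ∀ x, ‖x‖ ≤ R → |w x| ≤ M)
    (hfd : ∀ᵐ x, fderiv ℝ u x x = -c * ∫ y, w y * (inner ℝ (x - y) x / ‖x - y‖ ^ 2)) :
    (Module.finrank ℝ E - μ / 2) * (∫ x, w x) = q * c / 2 * (∫ x, w x) ^ 2 := by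
  obtain ⟨φ, L, M, hφ, hφs, hφL, hφ1, hφM, hφev⟩ := exists_radial_cutoffs (E := E)
  have hww : Integrable fun p : E × E => w p.1 * w p.2 := hw.mul_prod hw
  have hD : ∫ p : E × E, F p.1 * F p.2 / ‖p.1 - p.2‖ ^ μ = ∫ x, w x := by
    rw [Measure.volume_eq_prod, integral_prod _ hK]
    refine integral_congr_ae (ae_of_all _ fun x => ?_)
    simp only [mul_div_assoc, integral_const_mul, hwF]
    ring
  have hW : ∫ p : E × E, w p.1 * w p.2 = (∫ x, w x) ^ 2 := by
    rw [Measure.volume_eq_prod, integral_prod_mul, sq]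
  have hJM : ∀ m (p : E × E), p.1 ≠ p.2 →
      |inner ℝ (p.1 - p.2) (φ m p.1 • p.1 - φ m p.2 • p.2) / ‖p.1 - p.2‖ ^ 2| ≤ L :=
    fun m p hp => by
      have hz : 0 < ‖p.1 - p.2‖ := norm_pos_iff.2 (sub_ne_zero.2 hp)
      rw [abs_div, abs_of_pos (by positivity : 0 < ‖p.1 - p.2‖ ^ 2), div_le_iff₀ (by positivity)]
      exact hφL _ _ _
  have hlim := tendsto_integral_of_dominated_convergence (μ := (volume : Measure (E × E)))
    (F := fun (m : ℕ) p => ((Module.finrank ℝ E * φ m p.1 + fderiv ℝ (φ m) p.1 p.1) -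
        μ / 2 * (inner ℝ (p.1 - p.2) (φ m p.1 • p.1 - φ m p.2 • p.2) / ‖p.1 - p.2‖ ^ 2)) *
        (F p.1 * F p.2 / ‖p.1 - p.2‖ ^ μ) - q * c / 2 * (w p.1 * w p.2 *
        (inner ℝ (p.1 - p.2) (φ m p.1 • p.1 - φ m p.2 • p.2) / ‖p.1 - p.2‖ ^ 2)))
    (f := fun p => (Module.finrank ℝ E - μ / 2) * (F p.1 * F p.2 / ‖p.1 - p.2‖ ^ μ) -
      q * c / 2 * (w p.1 * w p.2))
    (fun p => ((Module.finrank ℝ E + M) + μ / 2 * L) * ‖F p.1 * F p.2 / ‖p.1 - p.2‖ ^ μ‖ +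
      |q * c / 2| * (‖w p.1 * w p.2‖ * L)) (fun m => ?_)
    ((hK.norm.const_mul _).add ((hww.norm.mul_const L).const_mul _)) (fun m => ?_) ?_
  · have h0 : ∫ p : E × E, ((Module.finrank ℝ E - μ / 2) * (F p.1 * F p.2 / ‖p.1 - p.2‖ ^ μ) -
        q * c / 2 * (w p.1 * w p.2)) = 0 := by
      refine tendsto_nhds_unique hlim (tendsto_const_nhds.congr fun m => ?_)
      exact (integral_virial_of_log_potential hμ0 hμ hE hu hFu hFi hK hFloc hwF hw hwloc hfd
        (hφ m) (hφs m) (hφL m)).symm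
    rw [integral_sub (hK.const_mul _) (hww.const_mul _), integral_const_mul, integral_const_mul,
      hD, hW] at h0
    linarith
  · have h1 := (hφ m).continuous.measurable
    have h2 : Continuous (fderiv ℝ (φ m)) := (hφ m).continuous_fderiv one_ne_zero
    have h3 : Measurable fun x => fderiv ℝ (φ m) x x := Continuous.measurable (by fun_prop)
    have h4 : Measurable fun p : E × E => fderiv ℝ (φ m) p.1 p.1 := h3.comp measurable_fst
    have hJ : Measurable fun p : E × E =>
        inner ℝ (p.1 - p.2) (φ m p.1 • p.1 - φ m p.2 • p.2) / ‖p.1 - p.2‖ ^ 2 := by fun_prop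
    refine (AEStronglyMeasurable.mul ?_ hK.1).sub
      ((hww.1.mul hJ.aestronglyMeasurable).const_mul _)
    exact Measurable.aestronglyMeasurable (by fun_prop)
  · filter_upwards [ae_prod_fst_ne_snd (E := E) (by omega)] with p hp
    have h1 := hJM m p hp
    set j := inner ℝ (p.1 - p.2) (φ m p.1 • p.1 - φ m p.2 • p.2) / ‖p.1 - p.2‖ ^ 2
    refine (norm_sub_le _ _).trans (add_le_add ?_ ?_)
    · rw [norm_mul]
      refine mul_le_mul_of_nonneg_right ?_ (norm_nonneg _)
      refine (norm_sub_le _ _).trans (add_le_add ((norm_add_le _ _).trans (add_le_add ?_ ?_)) ?_)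
      · rw [norm_mul, norm_of_nonneg (Nat.cast_nonneg _)]
        exact mul_le_of_le_one_right (Nat.cast_nonneg _) (hφ1 m _)
      · exact hφM m _
      · rw [norm_mul, norm_of_nonneg (by positivity : (0 : ℝ) ≤ μ / 2)]
        exact mul_le_mul_of_nonneg_left h1 (by positivity)
    · rw [norm_mul, norm_mul (_ * _), norm_eq_abs (q * c / 2)]
      gcongr
      exact h1
  · filter_upwards [ae_prod_fst_ne_snd (E := E) (by omega)] with p hp
    have hz : 0 < ‖p.1 - p.2‖ := norm_pos_iff.2 (sub_ne_zero.2 hp)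
    refine tendsto_const_nhds.congr' ?_
    filter_upwards [hφev p.1, hφev p.2] with m h1 h2
    rw [h1.1, h1.2, h2.1, one_smul, one_smul, real_inner_self_eq_norm_sq,
      div_self (by positivity)]
    ring

end Pohozaev

theorem betaN_pos {n : ℕ} (hn : 2 ≤ n) : 0 < betaN n := by
  have h0 : (0 : ℝ) < n := by exact_mod_cast (by omega : 0 < n)
  have h1 : 0 < Gamma ((n : ℝ) / 2 + 1) := Gamma_pos_of_pos (by positivity)
  have h2 : 0 < Gamma ((n : ℝ) / 2) := Gamma_pos_of_pos (by positivity)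
  have h3 : 0 < (volume (ball (0 : EuclideanSpace ℝ (Fin n)) 1)).toReal :=
    ENNReal.toReal_pos (measure_ball_pos _ _ one_pos).ne' measure_ball_lt_top.ne
  unfold betaN
  positivity

theorem alpha_eq_two (n : ℕ) (hn : 2 ≤ n) (μ : ℝ) (hμ0 : 0 < μ) (hμn : μ < n)
    (u : EuclideanSpace ℝ (Fin n) → ℝ) (hu : ContDiff ℝ n u)
    (hB : CondB n μ u) (hIE : IE n μ u) :
    alphaC n μ u = 2 ∧
    (∫ y : EuclideanSpace ℝ (Fin n), V n μ u y * Real.exp ((2 * n - μ) / 2 * u y)) =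
      2 * betaN n := by
  set F : EuclideanSpace ℝ (Fin n) → ℝ := fun y => exp ((2 * n - μ) / 2 * u y) with hFdef
  set w : EuclideanSpace ℝ (Fin n) → ℝ := fun y => V n μ u y * F y with hwdef
  have hd : Module.finrank ℝ (EuclideanSpace ℝ (Fin n)) = n := finrank_euclideanSpace_fin
  have hE : 2 ≤ Module.finrank ℝ (EuclideanSpace ℝ (Fin n)) := by omega
  have hμ : μ < Module.finrank ℝ (EuclideanSpace ℝ (Fin n)) := by rwa [hd]
  have hnt : Nontrivial (EuclideanSpace ℝ (Fin n)) :=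
    Module.nontrivial_of_finrank_pos (R := ℝ) (by omega)
  obtain ⟨C, hC⟩ := hIE
  have hFi : Integrable F := hB.1
  have hK : Integrable fun p : EuclideanSpace ℝ (Fin n) × EuclideanSpace ℝ (Fin n) =>
    F p.1 * F p.2 / ‖p.1 - p.2‖ ^ μ := hB.2
  have hu1 : ContDiff ℝ 1 u := hu.of_le (by exact_mod_cast (by omega : 1 ≤ n))
  have hFc : Continuous F := by
    have := hu1.continuous
    fun_prop
  have hFpos : ∀ x, 0 < F x := fun x => exp_pos _
  have hwF : ∀ x, w x = (∫ y, F y / ‖x - y‖ ^ μ) * F x := fun x => rfl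
  have hFloc : ∀ R : ℝ, ∃ M : ℝ, ∀ x, ‖x‖ ≤ R → |F x| ≤ M := fun R => by
    obtain ⟨M, hM⟩ := (isCompact_closedBall (0 : EuclideanSpace ℝ (Fin n))
      R).exists_bound_of_continuousOn hFc.continuousOn
    exact ⟨M, fun x hx => hM x (mem_closedBall_zero_iff.2 hx)⟩
  have hV := riesz_potential_bound hμ0.le hμ (by omega) hFi hFloc
  have hVpos : ∀ x, 0 < ∫ y, F y / ‖x - y‖ ^ μ := fun x => by
    obtain ⟨D, hD⟩ := hV ‖x‖
    rw [integral_pos_iff_support_of_nonneg (fun y => by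
      have := (hFpos y).le
      positivity) (hD x le_rfl).1]
    have h1 : ({x}ᶜ : Set (EuclideanSpace ℝ (Fin n))) ⊆
        Function.support fun y => F y / ‖x - y‖ ^ μ := fun y hy => by
      have h2 : 0 < ‖x - y‖ := norm_pos_iff.2 (sub_ne_zero.2 (Ne.symm hy))
      have h3 := hFpos y
      exact (by positivity : 0 < F y / ‖x - y‖ ^ μ).ne'
    exact (isOpen_compl_singleton.measure_pos volume
      (Set.nonempty_compl_of_nontrivial x)).trans_le (measure_mono h1)
  have hw : Integrable w := by
    have h1 := Integrable.integral_prod_left hK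
    refine h1.congr (ae_of_all _ fun x => ?_)
    simp only [mul_div_assoc, integral_const_mul, hwF]
    ring
  have hwloc : ∀ R : ℝ, ∃ M : ℝ, ∀ x, ‖x‖ ≤ R → |w x| ≤ M := fun R => by
    obtain ⟨M, hM⟩ := hFloc R
    obtain ⟨D, hD⟩ := hV R
    refine ⟨D * M, fun x hx => ?_⟩
    have h1 := (hD x hx).2
    simp only [abs_of_pos (hFpos _)] at h1
    rw [hwF, abs_mul, abs_of_pos (hVpos x)]
    exact mul_le_mul h1 (hM x hx) (abs_nonneg _) ((hVpos x).le.trans h1)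
  have hfd := fderiv_self_ae_eq_of_log_potential hE hw hwloc hu1 hC
  have hid := virial_identity_of_log_potential hμ0 hμ hE hu1 (fun x => rfl) hFi hK hFloc hwF hw
    hwloc hfd
  have hWpos : 0 < ∫ x, w x := by
    have hwpos : ∀ x, 0 < w x := fun x => mul_pos (hVpos x) (hFpos x)
    rw [integral_pos_iff_support_of_nonneg (fun x => (hwpos x).le) hw,
      Function.support_eq_univ fun x => (hwpos x).ne']
    exact isOpen_univ.measure_pos volume Set.univ_nonempty
  have hβ := betaN_pos hn
  have hα : 1 / betaN n * ∫ x, w x = 2 := by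
    rw [hd] at hid
    have hq : ((n : ℝ) - μ / 2) * (∫ x, w x) ≠ 0 := by
      refine mul_ne_zero ?_ hWpos.ne'
      linarith
    refine mul_left_cancel₀ hq ?_
    linear_combination -2 * hid
  refine ⟨hα, ?_⟩
  rw [one_div_mul_eq_div, div_eq_iff hβ.ne'] at hα
  exact hα
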